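/- Assume x = (x_1,…,x_n) is drawn from the volume sampling distribution γ_n^ν with ν = wμ, n > m, and w ≥ α·w_m μ-a.e. for some α > 0. Then for 0 < δ < 1: P(λ_min(G^w)^{-1} > (1−δ)^{-1}·n/(n−m)) ≤ m·exp(−c_δ(n−m)α/m). Moreover, if n ≥ m + m·c_δ^{-1}·α^{-1}·log(n·m²), then E(λ_min(G^w)^{-1}) ≤ 1 + (n/(n−m))·(1−δ)^{-1}. -/

import Mathlib

open MeasureTheory ProbabilityTheory Matrix Finset
open scoped ENNReal NNReal BigOperators RealInnerProductSpace

noncomputable section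

namespace WLSDPP

variable {𝓧 : Type*} [MeasurableSpace 𝓧]

/-- Smallest eigenvalue of a real symmetric matrix, via the Rayleigh quotient. -/
def lambdaMin {m : ℕ} (A : Matrix (Fin m) (Fin m) ℝ) : ℝ :=
  ⨅ v : {v : Fin m → ℝ // ∑ i, v i ^ 2 = 1}, (v : Fin m → ℝ) ⬝ᵥ A.mulVec v

/-- The feature vector `𝛗(x) = (φ₁(x),…,φ_m(x))ᵀ`. -/
def feat {m : ℕ} (φ : Fin m → 𝓧 → ℝ) (x : 𝓧) : Fin m → ℝ := fun j => φ j x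

/-- Empirical Gram matrix `G^w(x) = (1/n) ∑ᵢ w(xᵢ)⁻¹ 𝛗(xᵢ)𝛗(xᵢ)ᵀ`. -/
def gram {m n : ℕ} (φ : Fin m → 𝓧 → ℝ) (w : 𝓧 → ℝ) (x : Fin n → 𝓧) :
    Matrix (Fin m) (Fin m) ℝ :=
  (n : ℝ)⁻¹ • ∑ i, (w (x i))⁻¹ • vecMulVec (feat φ (x i)) (feat φ (x i))

/-- Empirical seminorm squared `‖f‖ₙ² = (1/n) ∑ᵢ w(xᵢ)⁻¹ f(xᵢ)²`. -/
def empSq {n : ℕ} (w : 𝓧 → ℝ) (f : 𝓧 → ℝ) (x : Fin n → 𝓧) : ℝ :=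
  (n : ℝ)⁻¹ * ∑ i, (w (x i))⁻¹ * f (x i) ^ 2

/-- Squared L²(μ) norm. -/
def l2Sq (μ : Measure 𝓧) (f : 𝓧 → ℝ) : ℝ := ∫ y, f y ^ 2 ∂μ

/-- L²(μ) norm. -/
def l2 (μ : Measure 𝓧) (f : 𝓧 → ℝ) : ℝ := Real.sqrt (l2Sq μ f)

/-- The element of `V_m` with coefficient vector `a`. -/
def lin {m : ℕ} (φ : Fin m → 𝓧 → ℝ) (a : Fin m → ℝ) : 𝓧 → ℝ := fun y => ∑ j, a j * φ j y

/-- The L²(μ)-orthogonal projection onto `V_m` (for `φ` an orthonormal basis of `V_m`). -/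
def projV {m : ℕ} (μ : Measure 𝓧) (φ : Fin m → 𝓧 → ℝ) (f : 𝓧 → ℝ) : 𝓧 → ℝ :=
  lin φ (fun j => ∫ y, φ j y * f y ∂μ)

/-- The right-hand side vector `b = (1/n) ∑ᵢ w(xᵢ)⁻¹ f(xᵢ) 𝛗(xᵢ)`. -/
def bVec {m n : ℕ} (φ : Fin m → 𝓧 → ℝ) (w : 𝓧 → ℝ) (f : 𝓧 → ℝ) (x : Fin n → 𝓧) :
    Fin m → ℝ :=
  (n : ℝ)⁻¹ • ∑ i, ((w (x i))⁻¹ * f (x i)) • feat φ (x i)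

/-- The weighted least-squares projection `P̂_{V_m} f = 𝛗(·)ᵀ (G^w)⁻¹ b`. -/
def lsProj {m n : ℕ} (φ : Fin m → 𝓧 → ℝ) (w : 𝓧 → ℝ) (f : 𝓧 → ℝ) (x : Fin n → 𝓧) :
    𝓧 → ℝ :=
  lin φ ((gram φ w x)⁻¹ *ᵥ bVec φ w f x)

/-- The measure with density `w` with respect to `μ`. -/
def dens (μ : Measure 𝓧) (w : 𝓧 → ℝ) : Measure 𝓧 :=
  μ.withDensity fun a => ENNReal.ofReal (w a)

/-- The inverse Christoffel density `w_m(x) = (1/m) ‖𝛗(x)‖₂²`. -/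
def wChr {m : ℕ} (φ : Fin m → 𝓧 → ℝ) : 𝓧 → ℝ := fun x => (m : ℝ)⁻¹ * ∑ i, φ i x ^ 2

/-- The feature matrix `Φ(x)` with `i`-th row `𝛗(xᵢ)ᵀ`. -/
def featM {m n : ℕ} (φ : Fin m → 𝓧 → ℝ) (x : Fin n → 𝓧) : Matrix (Fin n) (Fin m) ℝ :=
  Matrix.of fun i j => φ j (x i)

/-- The weighted feature matrix `Φ^w(x)` with `i`-th row `w(xᵢ)^{-1/2} 𝛗(xᵢ)ᵀ`. -/
def featW {m n : ℕ} (φ : Fin m → 𝓧 → ℝ) (w : 𝓧 → ℝ) (x : Fin n → 𝓧) :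
    Matrix (Fin n) (Fin m) ℝ :=
  Matrix.of fun i j => (Real.sqrt (w (x i)))⁻¹ * φ j (x i)

/-- The projection DPP `γ_m`, with density `(1/m!) det(Φ(x)ᵀΦ(x))` w.r.t. `μ^⊗m`. -/
def dpp {m : ℕ} (μ : Measure 𝓧) (φ : Fin m → 𝓧 → ℝ) : Measure (Fin m → 𝓧) :=
  (Measure.pi fun _ : Fin m => μ).withDensity fun x =>
    ENNReal.ofReal ((m.factorial : ℝ)⁻¹ * ((featM φ x)ᵀ * featM φ x).det)

/-- The generalized volume sampling distribution `γ_n^ν`, `ν = wμ`, with density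
`n^m ((n−m)!/n!) det(G^w(x))` with respect to `ν^⊗n`. -/
def vs {m : ℕ} (μ : Measure 𝓧) (φ : Fin m → 𝓧 → ℝ) (w : 𝓧 → ℝ) (n : ℕ) :
    Measure (Fin n → 𝓧) :=
  (Measure.pi fun _ : Fin n => dens μ w).withDensity fun x =>
    ENNReal.ofReal ((n : ℝ) ^ m * ((n - m).factorial : ℝ) / (n.factorial : ℝ) *
      (gram φ w x).det)

/-- `c_δ = δ + (1−δ) log(1−δ)`. -/
def cDelta (δ : ℝ) : ℝ := δ + (1 - δ) * Real.log (1 - δ)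

/-- `φ₁, …, φ_m` is an orthonormal system in `L²_μ`. -/
def IsONB {m : ℕ} (μ : Measure 𝓧) (φ : Fin m → 𝓧 → ℝ) : Prop :=
  ∀ i j, ∫ y, φ i y * φ j y ∂μ = if i = j then (1 : ℝ) else 0

end WLSDPP

namespace WLSDPP

open Filter Topology Asymptotics

theorem norm_pow_sub_pow_le_mul {𝔸 : Type*} [NormedRing 𝔸] [NormOneClass 𝔸] {a b : 𝔸} {C : ℝ}
    (ha : ‖a‖ ≤ C) (hb : ‖b‖ ≤ C) (hC : 1 ≤ C) (N : ℕ) :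
    ‖a ^ N - b ^ N‖ ≤ N * C ^ N * ‖a - b‖ := by
  induction N with
  | zero => simp
  | succ N ih =>
    have h1 : a ^ (N + 1) - b ^ (N + 1) = a ^ N * (a - b) + (a ^ N - b ^ N) * b := by
      rw [pow_succ, pow_succ]; noncomm_ring
    have h2 : ‖a ^ N‖ ≤ C ^ N := (norm_pow_le a N).trans (by gcongr)
    have h3 : C ^ N ≤ C ^ (N + 1) := pow_le_pow_right₀ hC (by omega)
    calc ‖a ^ (N + 1) - b ^ (N + 1)‖ ≤ ‖a ^ N‖ * ‖a - b‖ + ‖a ^ N - b ^ N‖ * ‖b‖ := by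
          rw [h1]
          exact (norm_add_le _ _).trans (add_le_add (norm_mul_le _ _) (norm_mul_le _ _))
      _ ≤ C ^ (N + 1) * ‖a - b‖ + (N * C ^ N * ‖a - b‖) * C := by
          gcongr
          exact h2.trans h3
      _ = (N + 1 : ℕ) * C ^ (N + 1) * ‖a - b‖ := by push_cast; ring

theorem norm_exp_le_exp_norm_of_normOneClass {𝔸 : Type*} [NormedRing 𝔸] [NormedAlgebra ℝ 𝔸]
    [CompleteSpace 𝔸] [NormOneClass 𝔸] (x : 𝔸) : ‖NormedSpace.exp x‖ ≤ Real.exp ‖x‖ := by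
  have h : HasSum (fun k : ℕ => ((k.factorial : ℝ)⁻¹) • ‖x‖ ^ k) (NormedSpace.exp ‖x‖) :=
    NormedSpace.exp_series_hasSum_exp' (𝕂 := ℝ) ‖x‖
  rw [← Real.exp_eq_exp_ℝ] at h
  rw [NormedSpace.exp_eq_tsum ℝ]
  refine tsum_of_norm_bounded h fun k => ?_
  rw [norm_smul, Real.norm_of_nonneg (by positivity), smul_eq_mul]
  gcongr
  exact norm_pow_le x k

theorem tendsto_pow_exp_mul_exp {𝔸 : Type*} [NormedRing 𝔸] [NormedAlgebra ℝ 𝔸]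
    [CompleteSpace 𝔸] [NormOneClass 𝔸] (x y : 𝔸) :
    Tendsto (fun N : ℕ => (NormedSpace.exp ((N : ℝ)⁻¹ • x) * NormedSpace.exp ((N : ℝ)⁻¹ • y)) ^ N)
      atTop (𝓝 (NormedSpace.exp (x + y))) := by
  let _ : NormedAlgebra ℚ 𝔸 := NormedAlgebra.restrictScalars ℚ ℝ 𝔸
  have hd : HasDerivAt (fun t : ℝ => NormedSpace.exp (t • x) * NormedSpace.exp (t • y)
      - NormedSpace.exp (t • (x + y))) 0 0 := by
    have h1 := hasDerivAt_exp_smul_const (𝕂 := ℝ) x 0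
    have h2 := hasDerivAt_exp_smul_const (𝕂 := ℝ) y 0
    have h3 := hasDerivAt_exp_smul_const (𝕂 := ℝ) (x + y) 0
    exact ((h1.mul h2).sub h3).congr_deriv (by simp)
  have ho := hd.isLittleO
  simp only [zero_smul, NormedSpace.exp_zero, mul_one, sub_self, smul_zero, sub_zero] at ho
  have hinv : Tendsto (fun N : ℕ => (N : ℝ)⁻¹) atTop (𝓝 0) := tendsto_inv_atTop_nhds_zero_nat
  have ho' := ho.comp_tendsto hinv
  have hbound : ∀ z : 𝔸, ∀ t : ℝ, 0 ≤ t → ‖NormedSpace.exp (t • z)‖ ≤ Real.exp (t * ‖z‖) := by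
    intro z t ht
    refine (norm_exp_le_exp_norm_of_normOneClass (t • z)).trans ?_
    rw [norm_smul, Real.norm_of_nonneg ht]
  have hlim : Tendsto (fun N : ℕ => Real.exp (‖x‖ + ‖y‖) * ((N : ℝ) *
      ‖NormedSpace.exp ((N : ℝ)⁻¹ • x) * NormedSpace.exp ((N : ℝ)⁻¹ • y)
        - NormedSpace.exp ((N : ℝ)⁻¹ • (x + y))‖)) atTop (𝓝 0) := by
    rw [← mul_zero (Real.exp (‖x‖ + ‖y‖))]
    refine Tendsto.const_mul _ ?_
    have := ho'.norm_left.norm_right.tendsto_div_nhds_zero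
    refine this.congr fun N => ?_
    simp [div_eq_mul_inv, mul_comm]
  rw [tendsto_iff_norm_sub_tendsto_zero]
  refine squeeze_zero' (Eventually.of_forall fun _ => norm_nonneg _) ?_ hlim
  filter_upwards [eventually_gt_atTop 0] with N hN
  have hN0 : (N : ℝ) ≠ 0 := by positivity
  have hpow : NormedSpace.exp (x + y) = NormedSpace.exp ((N : ℝ)⁻¹ • (x + y)) ^ N := by
    rw [← NormedSpace.exp_nsmul, ← Nat.cast_smul_eq_nsmul ℝ, smul_smul, mul_inv_cancel₀ hN0,
      one_smul]
  have hinv0 : 0 ≤ (N : ℝ)⁻¹ := by positivity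
  have key := norm_pow_sub_pow_le_mul (C := Real.exp ((N : ℝ)⁻¹ * (‖x‖ + ‖y‖))) (N := N)
    (a := NormedSpace.exp ((N : ℝ)⁻¹ • x) * NormedSpace.exp ((N : ℝ)⁻¹ • y))
    (b := NormedSpace.exp ((N : ℝ)⁻¹ • (x + y)))
    (by
      rw [mul_add, Real.exp_add]
      refine (norm_mul_le _ _).trans ?_
      gcongr <;> exact hbound _ _ hinv0)
    ((hbound _ _ hinv0).trans (by gcongr; exact norm_add_le _ _))
    (Real.one_le_exp (by positivity))
  rw [hpow]
  refine key.trans (le_of_eq ?_)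
  rw [← Real.exp_nat_mul, ← mul_assoc (N : ℝ) (N : ℝ)⁻¹, mul_inv_cancel₀ hN0, one_mul]
  ring

theorem trace_mul_pow_comm {ι : Type*} [Fintype ι] [DecidableEq ι] (C D : Matrix ι ι ℝ) (q : ℕ) :
    trace ((C * D) ^ q) = trace ((D * C) ^ q) := by
  cases q with
  | zero => simp
  | succ q =>
    have h : ∀ k : ℕ, (C * D) ^ k * C = C * (D * C) ^ k := fun k => by
      induction k with
      | zero => simp
      | succ k ih => rw [pow_succ, mul_assoc, mul_assoc C D C, ← mul_assoc _ C, ih, mul_assoc, ← pow_succ]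
    rw [pow_succ, ← mul_assoc, h, trace_mul_comm, ← mul_assoc, ← pow_succ']

theorem trace_mul_sq_le {ι : Type*} [Fintype ι] [DecidableEq ι] (C D : Matrix ι ι ℝ) :
    trace (C * D) ^ 2 ≤ trace (C * Cᵀ) * trace (D * Dᵀ) := by
  have h1 : trace (C * D) = ∑ p : ι × ι, C p.1 p.2 * D p.2 p.1 := by
    simp [trace, mul_apply, Fintype.sum_prod_type]
  have h2 : trace (C * Cᵀ) = ∑ p : ι × ι, C p.1 p.2 ^ 2 := by
    simp [trace, mul_apply, Fintype.sum_prod_type, sq]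
  have h3 : trace (D * Dᵀ) = ∑ p : ι × ι, D p.2 p.1 ^ 2 := by
    rw [trace_mul_comm]
    simp [trace, mul_apply, Fintype.sum_prod_type, sq]
  rw [h1, h2, h3]
  exact sum_mul_sq_le_sq_mul_sq _ _ _

theorem trace_mul_transpose_pow_nonneg {ι : Type*} [Fintype ι] [DecidableEq ι]
    (A : Matrix ι ι ℝ) (q : ℕ) : 0 ≤ trace ((A * Aᵀ) ^ q) := by
  have := (posSemidef_self_mul_conjTranspose A).pow q
  rw [conjTranspose_eq_transpose_of_trivial] at this
  exact this.trace_nonneg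

theorem trace_mul_pow_two_pow_sq_le {ι : Type*} [Fintype ι] [DecidableEq ι] (k : ℕ) :
    ∀ C D : Matrix ι ι ℝ, trace ((C * D) ^ 2 ^ k) ^ 2 ≤
      trace ((C * Cᵀ) ^ 2 ^ k) * trace ((D * Dᵀ) ^ 2 ^ k) := by
  induction k with
  | zero => intro C D; simpa using trace_mul_sq_le C D
  | succ k ih =>
    intro C D
    have h1 := ih (C * D) (C * D)
    have h2 : trace ((C * D * (C * D)ᵀ) ^ 2 ^ k) = trace ((D * Dᵀ * (Cᵀ * C)) ^ 2 ^ k) := by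
      rw [transpose_mul, mul_assoc, trace_mul_pow_comm]
      simp only [mul_assoc]
    have h3 := ih (D * Dᵀ) (Cᵀ * C)
    have h4 : trace ((C * Cᵀ) ^ 2 ^ (k + 1)) = trace ((Cᵀ * C * (Cᵀ * C)ᵀ) ^ 2 ^ k) := by
      rw [trace_mul_pow_comm, transpose_mul, transpose_transpose, ← sq, ← pow_mul, pow_succ']
    have h5 : trace ((D * Dᵀ) ^ 2 ^ (k + 1)) = trace ((D * Dᵀ * (D * Dᵀ)ᵀ) ^ 2 ^ k) := by
      rw [transpose_mul, transpose_transpose, ← sq, ← pow_mul, pow_succ']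
    have h6 : (C * D) ^ 2 ^ (k + 1) = (C * D * (C * D)) ^ 2 ^ k := by
      rw [← sq, ← pow_mul, pow_succ']
    rw [h4, h5, h6]
    rw [h2] at h1
    linarith

theorem trace_mul_pow_two_pow_le {ι : Type*} [Fintype ι] [DecidableEq ι] (k : ℕ) :
    ∀ {A B : Matrix ι ι ℝ}, A.IsSymm → B.IsSymm →
      trace ((A * B) ^ 2 ^ k) ≤ trace (A ^ 2 ^ k * B ^ 2 ^ k) := by
  induction k with
  | zero => intro A B _ _; simp
  | succ k ih =>
    intro A B hA hB
    have h := trace_mul_pow_two_pow_sq_le k (A * B) (A * B)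
    have h0 := trace_mul_transpose_pow_nonneg (A * B) (2 ^ k)
    rw [← sq, ← sq, ← pow_mul, ← pow_succ'] at h
    have h2 : trace ((A * B * (A * B)ᵀ) ^ 2 ^ k) = trace ((A ^ 2 * B ^ 2) ^ 2 ^ k) := by
      rw [transpose_mul, hA.eq, hB.eq, mul_assoc, trace_mul_pow_comm, mul_assoc, mul_assoc,
        ← sq, ← mul_assoc, ← sq, trace_mul_pow_comm]
    have h3 := ih (A := A ^ 2) (B := B ^ 2) (hA.pow 2) (hB.pow 2)
    rw [← pow_mul, ← pow_mul, ← pow_succ'] at h3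
    exact (le_of_abs_le (abs_le_of_sq_le_sq h h0)).trans (h2.le.trans h3)

section

attribute [local instance] Matrix.linftyOpNormedRing Matrix.linftyOpNormedAlgebra

theorem trace_exp_add_le {ι : Type*} [Fintype ι] [DecidableEq ι] {A B : Matrix ι ι ℝ}
    (hA : A.IsSymm) (hB : B.IsSymm) :
    trace (NormedSpace.exp (A + B)) ≤ trace (NormedSpace.exp A * NormedSpace.exp B) := by
  cases isEmpty_or_nonempty ι
  · simp [trace]
  have := Matrix.linfty_opNormOneClass (n := ι) (α := ℝ)
  have hl := (tendsto_pow_exp_mul_exp A B).comp (tendsto_pow_atTop_atTop_of_one_lt one_lt_two)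
  have hl' := ((continuous_id.matrix_trace).tendsto _).comp hl
  refine le_of_tendsto hl' (Eventually.of_forall fun k => ?_)
  have h := trace_mul_pow_two_pow_le k
    (hA.smul (((2 ^ k : ℕ) : ℝ)⁻¹)).exp (hB.smul (((2 ^ k : ℕ) : ℝ)⁻¹)).exp
  rw [← Matrix.exp_nsmul, ← Matrix.exp_nsmul, ← Nat.cast_smul_eq_nsmul ℝ,
    ← Nat.cast_smul_eq_nsmul ℝ, smul_smul, smul_smul, mul_inv_cancel₀ (by positivity), one_smul,
    one_smul] at h
  exact h

end

end WLSDPP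

namespace WLSDPP

section

attribute [local instance] Matrix.linftyOpNormedRing Matrix.linftyOpNormedAlgebra

theorem continuous_matrix_exp {ι : Type*} [Fintype ι] [DecidableEq ι] :
    Continuous (NormedSpace.exp : Matrix ι ι ℝ → Matrix ι ι ℝ) := by
  let _ : NormedAlgebra ℚ (Matrix ι ι ℝ) := NormedAlgebra.restrictScalars ℚ ℝ _
  exact NormedSpace.exp_continuous

theorem hasSum_matrix_exp {ι : Type*} [Fintype ι] [DecidableEq ι] (A : Matrix ι ι ℝ) :
    HasSum (fun k : ℕ => ((k.factorial : ℝ)⁻¹) • A ^ k) (NormedSpace.exp A) :=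
  NormedSpace.exp_series_hasSum_exp' (𝕂 := ℝ) A

end

theorem hasSum_real_exp (t : ℝ) :
    HasSum (fun k : ℕ => ((k.factorial : ℝ)⁻¹) • t ^ k) (Real.exp t) := by
  rw [Real.exp_eq_exp_ℝ]
  exact NormedSpace.exp_series_hasSum_exp' (𝕂 := ℝ) t

theorem exp_smul_of_isIdempotentElem {ι : Type*} [Fintype ι] [DecidableEq ι] {E : Matrix ι ι ℝ}
    (hE : IsIdempotentElem E) (s : ℝ) :
    NormedSpace.exp (s • E) = 1 + (Real.exp s - 1) • E := by
  refine (hasSum_matrix_exp (s • E)).unique ?_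
  have h := (hasSum_ite_eq (0 : ℕ) (1 - E)).add ((hasSum_real_exp s).smul_const E)
  convert h using 1
  · ext1 k
    rcases k with _ | k
    · simp
    · simp [smul_pow, hE.pow_succ_eq, smul_smul]
  · module

theorem exp_mulVec_of_mulVec_eq {ι : Type*} [Fintype ι] [DecidableEq ι] {A : Matrix ι ι ℝ}
    {v : ι → ℝ} {l : ℝ} (h : A *ᵥ v = l • v) :
    NormedSpace.exp A *ᵥ v = Real.exp l • v := by
  have hp : ∀ k : ℕ, A ^ k *ᵥ v = l ^ k • v := fun k => by
    induction k with
    | zero => simp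
    | succ k ih => rw [pow_succ', ← mulVec_mulVec, ih, mulVec_smul, h, smul_smul, pow_succ]
  have h1 := (hasSum_matrix_exp A).map
    (AddMonoidHom.mk' (fun M : Matrix ι ι ℝ => M *ᵥ v) fun M N => add_mulVec M N v)
    (continuous_id.matrix_mulVec continuous_const)
  refine h1.unique ?_
  convert (hasSum_real_exp l).smul_const v using 1
  ext1 k
  simp [smul_mulVec, hp, smul_smul]

theorem posSemidef_exp {ι : Type*} [Fintype ι] [DecidableEq ι] {A : Matrix ι ι ℝ}
    (hA : A.IsSymm) : (NormedSpace.exp A).PosSemidef := by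
  have h := posSemidef_self_mul_conjTranspose (NormedSpace.exp ((2 : ℝ)⁻¹ • A))
  rw [conjTranspose_eq_transpose_of_trivial, ((hA.smul (2 : ℝ)⁻¹).exp).eq, ← sq,
    ← Matrix.exp_nsmul, ← Nat.cast_smul_eq_nsmul ℝ, smul_smul] at h
  simpa using h

theorem dotProduct_mulVec_le_trace {ι : Type*} [Fintype ι] [DecidableEq ι] {P : Matrix ι ι ℝ}
    (hP : P.PosSemidef) {v : ι → ℝ} (hv : v ⬝ᵥ v = 1) : v ⬝ᵥ P *ᵥ v ≤ P.trace := by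
  obtain ⟨m, u, rfl⟩ := posSemidef_iff_eq_sum_vecMulVec.1 hP
  rw [sum_mulVec, dotProduct_sum, trace_sum]
  refine sum_le_sum fun i _ => ?_
  rw [trace_vecMulVec, star_trivial, vecMulVec_mulVec, dotProduct_smul]
  have := sum_mul_sq_le_sq_mul_sq univ v (u i)
  have hv' : ∑ j, v j ^ 2 = 1 := by simpa [dotProduct, sq] using hv
  rw [hv', one_mul] at this
  calc _ = (∑ j, v j * u i j) ^ 2 := by
        simp [dotProduct, sq, mul_comm]
    _ ≤ _ := this
    _ = _ := by simp [dotProduct, sq]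

theorem dotProduct_self_nonneg_real {ι : Type*} [Fintype ι] (v : ι → ℝ) : 0 ≤ v ⬝ᵥ v :=
  sum_nonneg fun i _ => mul_self_nonneg (v i)

theorem exp_vecMulVec_self {ι : Type*} [Fintype ι] [DecidableEq ι] {v : ι → ℝ}
    (hv : v ⬝ᵥ v ≠ 0) (s : ℝ) :
    NormedSpace.exp (s • vecMulVec v v) =
      1 + ((Real.exp (s * (v ⬝ᵥ v)) - 1) / (v ⬝ᵥ v)) • vecMulVec v v := by
  have hE : IsIdempotentElem ((v ⬝ᵥ v)⁻¹ • vecMulVec v v) := by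
    rw [IsIdempotentElem, smul_mul_smul_comm, vecMulVec_mul_vecMulVec, vecMulVec_smul, smul_smul]
    congr 1
    field_simp
  have h := exp_smul_of_isIdempotentElem hE (s * (v ⬝ᵥ v))
  rw [smul_smul, smul_smul, mul_assoc, mul_inv_cancel₀ hv, mul_one, ← div_eq_mul_inv] at h
  exact h

theorem one_sub_exp_chord {r R θ : ℝ} (hr : 0 ≤ r) (hrR : r ≤ R) (hR : 0 < R) :
    r * ((1 - Real.exp (-(θ * R))) / R) ≤ 1 - Real.exp (-(θ * r)) := by
  have h := convexOn_exp.2 (Set.mem_univ 0) (Set.mem_univ (-(θ * R)))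
    (show 0 ≤ 1 - r / R by rw [sub_nonneg, div_le_one hR]; exact hrR)
    (show 0 ≤ r / R by positivity) (by ring)
  have e : (1 - r / R) • (0 : ℝ) + (r / R) • (-(θ * R)) = -(θ * r) := by
    simp only [smul_eq_mul]; field_simp; ring
  rw [e] at h
  simp only [smul_eq_mul, Real.exp_zero] at h
  have : r * ((1 - Real.exp (-(θ * R))) / R) = r / R * (1 - Real.exp (-(θ * R))) := by ring
  rw [this]; linarith

theorem trace_exp_add_vecMulVec_le {ι : Type*} [Fintype ι] [DecidableEq ι] {S : Matrix ι ι ℝ}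
    (hS : S.IsSymm) {v : ι → ℝ} {R θ : ℝ} (hR : 0 < R) (hv : v ⬝ᵥ v ≤ R) :
    trace (NormedSpace.exp (-θ • (S + vecMulVec v v))) ≤ trace (NormedSpace.exp (-θ • S)) -
      (1 - Real.exp (-(θ * R))) / R * (v ⬝ᵥ NormedSpace.exp (-θ • S) *ᵥ v) := by
  by_cases h0 : v ⬝ᵥ v = 0
  · obtain rfl := dotProduct_self_eq_zero.1 h0
    simp
  have hr : 0 ≤ v ⬝ᵥ v := dotProduct_self_nonneg_real v
  have hX : (vecMulVec v v).IsSymm := transpose_vecMulVec v v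
  have h1 := trace_exp_add_le (hS.smul (-θ)) (hX.smul (-θ))
  rw [← smul_add, exp_vecMulVec_self h0, mul_add, mul_one, trace_add, Matrix.mul_smul, trace_smul,
    mul_vecMulVec, trace_vecMulVec, dotProduct_comm _ v] at h1
  have hP : 0 ≤ v ⬝ᵥ NormedSpace.exp (-θ • S) *ᵥ v :=
    (posSemidef_exp (hS.smul (-θ))).dotProduct_mulVec_nonneg v
  have hc : (1 - Real.exp (-(θ * R))) / R ≤ (1 - Real.exp (-(θ * (v ⬝ᵥ v)))) / (v ⬝ᵥ v) := by
    rw [le_div_iff₀' (lt_of_le_of_ne hr (Ne.symm h0))]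
    exact one_sub_exp_chord hr hv hR
  have h2 := mul_le_mul_of_nonneg_right hc hP
  refine h1.trans ?_
  have e : (Real.exp (-θ * (v ⬝ᵥ v)) - 1) / (v ⬝ᵥ v) =
    -((1 - Real.exp (-(θ * (v ⬝ᵥ v)))) / (v ⬝ᵥ v)) := by rw [neg_mul]; ring
  rw [e, smul_eq_mul, dotProduct_comm (NormedSpace.exp (-θ • S) *ᵥ v) v]
  linarith

theorem trace_exp_add_sum_le {ι κ : Type*} [Fintype ι] [DecidableEq ι] {S : Matrix ι ι ℝ}
    (hS : S.IsSymm) (s : Finset κ) (v : κ → ι → ℝ) {θ : ℝ} (hθ : 0 ≤ θ) :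
    trace (NormedSpace.exp (-θ • (S + ∑ i ∈ s, vecMulVec (v i) (v i)))) ≤
      trace (NormedSpace.exp (-θ • S)) := by
  classical
  induction s using Finset.induction_on with
  | empty => simp
  | insert a s ha ih =>
    have hS' : (S + ∑ i ∈ s, vecMulVec (v i) (v i)).IsSymm := by
      rw [IsSymm, transpose_add, transpose_sum, hS.eq]
      simp only [transpose_vecMulVec]
    have h := trace_exp_add_vecMulVec_le hS' (v := v a) (R := v a ⬝ᵥ v a + 1) (θ := θ)
      (by linarith [dotProduct_self_nonneg_real (v a)]) (by linarith)
    have hP : 0 ≤ v a ⬝ᵥ NormedSpace.exp (-θ • (S + ∑ i ∈ s, vecMulVec (v i) (v i))) *ᵥ v a :=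
      (posSemidef_exp (hS'.smul (-θ))).dotProduct_mulVec_nonneg (v a)
    have hr : 0 ≤ v a ⬝ᵥ v a + 1 := by linarith [dotProduct_self_nonneg_real (v a)]
    have hc : 0 ≤ (1 - Real.exp (-(θ * (v a ⬝ᵥ v a + 1)))) / (v a ⬝ᵥ v a + 1) := by
      refine div_nonneg ?_ hr
      rw [sub_nonneg, Real.exp_le_one_iff]
      nlinarith
    rw [sum_insert ha, add_comm (vecMulVec _ _), ← add_assoc]
    nlinarith [mul_nonneg hc hP]

theorem exists_eigenvector_lambdaMin {m : ℕ} (hm : 0 < m) {A : Matrix (Fin m) (Fin m) ℝ}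
    (hA : A.IsSymm) : ∃ v : Fin m → ℝ, v ⬝ᵥ v = 1 ∧ A *ᵥ v = lambdaMin A • v := by
  have hcont : Continuous fun v : Fin m → ℝ => v ⬝ᵥ A *ᵥ v :=
    continuous_id.dotProduct (continuous_const.matrix_mulVec continuous_id)
  have hK : IsCompact {v : Fin m → ℝ | ∑ i, v i ^ 2 = 1} := by
    refine Metric.isCompact_of_isClosed_isBounded
      (isClosed_eq (by fun_prop) continuous_const) ?_
    refine (Metric.isBounded_closedBall (x := (0 : Fin m → ℝ)) (r := 1)).subset fun v hv => ?_
    rw [mem_closedBall_zero_iff, pi_norm_le_iff_of_nonneg zero_le_one]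
    intro i
    rw [Real.norm_eq_abs, ← sq_le_one_iff_abs_le_one]
    exact (single_le_sum (f := fun i => v i ^ 2) (fun i _ => sq_nonneg _) (mem_univ i)).trans_eq hv
  have hne : {v : Fin m → ℝ | ∑ i, v i ^ 2 = 1}.Nonempty :=
    ⟨Pi.single ⟨0, hm⟩ 1, by simp [Pi.single_apply]⟩
  obtain ⟨v, hv, hmin⟩ := hK.exists_isMinOn hne hcont.continuousOn
  have hv1 : v ⬝ᵥ v = 1 := by simpa [dotProduct, sq] using hv
  have hl : lambdaMin A = v ⬝ᵥ A *ᵥ v := by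
    have : Nonempty {v : Fin m → ℝ // ∑ i, v i ^ 2 = 1} := ⟨⟨v, hv⟩⟩
    refine le_antisymm (ciInf_le ⟨v ⬝ᵥ A *ᵥ v, ?_⟩ (⟨v, hv⟩ : {v : Fin m → ℝ // _}))
      (le_ciInf fun u => hmin u.2)
    rintro _ ⟨u, rfl⟩
    exact hmin u.2
  have hpsd : (A - lambdaMin A • (1 : Matrix (Fin m) (Fin m) ℝ)).PosSemidef := by
    refine PosSemidef.of_dotProduct_mulVec_nonneg ?_ fun u => ?_
    · rw [IsHermitian, conjTranspose_eq_transpose_of_trivial, transpose_sub, transpose_smul,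
        transpose_one, hA.eq]
    · rw [star_trivial, sub_mulVec, smul_mulVec, one_mulVec, dotProduct_sub, dotProduct_smul,
        smul_eq_mul]
      by_cases hu : u ⬝ᵥ u = 0
      · rw [dotProduct_self_eq_zero.1 hu]; simp
      have hu0 : 0 < u ⬝ᵥ u := lt_of_le_of_ne (dotProduct_self_nonneg_real u) (Ne.symm hu)
      have h1 : (Real.sqrt (u ⬝ᵥ u))⁻¹ * (Real.sqrt (u ⬝ᵥ u))⁻¹ = (u ⬝ᵥ u)⁻¹ := by
        rw [← mul_inv, Real.mul_self_sqrt hu0.le]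
      have hmem : (Real.sqrt (u ⬝ᵥ u))⁻¹ • u ∈ {v : Fin m → ℝ | ∑ i, v i ^ 2 = 1} := by
        have : ((Real.sqrt (u ⬝ᵥ u))⁻¹ • u) ⬝ᵥ ((Real.sqrt (u ⬝ᵥ u))⁻¹ • u) = 1 := by
          rw [dotProduct_smul, smul_dotProduct, smul_smul, h1, smul_eq_mul, inv_mul_cancel₀ hu]
        simpa only [dotProduct, ← sq, Set.mem_ofPred_eq] using this
      have h2 : v ⬝ᵥ A *ᵥ v ≤ _ := hmin hmem
      simp only [mulVec_smul, dotProduct_smul, smul_dotProduct, smul_smul, h1] at h2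
      rw [smul_eq_mul, ← hl, le_inv_mul_iff₀ hu0] at h2
      linarith
  refine ⟨v, hv1, ?_⟩
  have h0 := (hpsd.dotProduct_mulVec_zero_iff v).1 (by
    rw [star_trivial, sub_mulVec, smul_mulVec, one_mulVec, dotProduct_sub, dotProduct_smul,
      smul_eq_mul, hv1, hl]; ring)
  rw [sub_mulVec, smul_mulVec, one_mulVec, sub_eq_zero] at h0
  exact h0

theorem one_le_exp_mul_trace_exp {m : ℕ} (hm : 0 < m) {A : Matrix (Fin m) (Fin m) ℝ}
    (hA : A.IsSymm) {θ s : ℝ} (hθ : 0 ≤ θ) (h : lambdaMin A ≤ s) :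
    1 ≤ Real.exp (θ * s) * trace (NormedSpace.exp (-θ • A)) := by
  obtain ⟨v, hv, hAv⟩ := exists_eigenvector_lambdaMin hm hA
  have h1 : (-θ • A) *ᵥ v = (-θ * lambdaMin A) • v := by rw [smul_mulVec, hAv, smul_smul]
  have h2 := dotProduct_mulVec_le_trace (posSemidef_exp (hA.smul (-θ))) hv
  rw [exp_mulVec_of_mulVec_eq h1, dotProduct_smul, hv, smul_eq_mul, mul_one] at h2
  calc (1 : ℝ) ≤ Real.exp (θ * s) * Real.exp (-θ * lambdaMin A) := by
        rw [← Real.exp_add]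
        exact Real.one_le_exp (by nlinarith)
    _ ≤ _ := by gcongr

theorem inv_lambdaMin_mul_det_le {m : ℕ} {A : Matrix (Fin (m + 1)) (Fin (m + 1)) ℝ}
    (hA : A.PosSemidef) : (lambdaMin A)⁻¹ * A.det ≤ A.adjugate.trace := by
  have hs : A.IsSymm :=
    (conjTranspose_eq_transpose_of_trivial A).symm.trans hA.isHermitian
  obtain ⟨v, hv, hAv⟩ := exists_eigenvector_lambdaMin m.succ_pos hs
  by_cases hd : A.det = 0
  · rw [hd, mul_zero]
    refine sum_nonneg fun i _ => ?_
    rw [diag_apply, adjugate_fin_succ_eq_det_submatrix, ← two_mul, pow_mul, neg_one_sq, one_pow,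
      one_mul]
    exact (hA.submatrix _).det_nonneg
  have hu : IsUnit A.det := isUnit_iff_ne_zero.2 hd
  have hadj : A.adjugate = A.det • A⁻¹ := by
    rw [Matrix.inv_def, smul_smul, Ring.mul_inverse_cancel _ hu, one_smul]
  have h1 : A⁻¹ *ᵥ v = (lambdaMin A)⁻¹ • v := by
    have h := congrArg (fun u => A⁻¹ *ᵥ u) hAv
    simp only [mulVec_mulVec, nonsing_inv_mul _ hu, one_mulVec, mulVec_smul] at h
    have hl : lambdaMin A ≠ 0 := by
      intro h0
      rw [h0, zero_smul] at h
      simp [h] at hv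
    rw [eq_inv_smul_iff₀ hl]
    exact h.symm
  have h2 := dotProduct_mulVec_le_trace hA.inv hv
  rw [h1, dotProduct_smul, hv, smul_eq_mul, mul_one] at h2
  rw [hadj, trace_smul, smul_eq_mul, mul_comm]
  exact mul_le_mul_of_nonneg_left h2 hA.det_nonneg

theorem det_sum_vecMulVec {k : ℕ} {κ : Type*} [Fintype κ] [DecidableEq κ] (u : κ → Fin k → ℝ) :
    (∑ i, vecMulVec (u i) (u i)).det =
      (k.factorial : ℝ)⁻¹ * ∑ f : Fin k → κ, (Matrix.of fun j l => u (f j) l).det ^ 2 := by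
  have h1 : (∑ i, vecMulVec (u i) (u i)).det =
      ∑ f : Fin k → κ, (∏ j, u (f j) j) * (Matrix.of fun j l => u (f j) l).det := by
    have e : (∑ i, vecMulVec (u i) (u i)) = (fun j => ∑ i, u i j • u i) := by
      ext j l
      simp [Matrix.sum_apply, vecMulVec_apply]
    have h := (detRowAlternating (R := ℝ) (n := Fin k)).toMultilinearMap.map_sum
      (fun (j : Fin k) (i : κ) => u i j • u i)
    calc _ = detRowAlternating (R := ℝ) (fun j => ∑ i, u i j • u i) := by rw [e]; rfl
      _ = _ := h
      _ = _ := by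
        refine sum_congr rfl fun f _ => ?_
        exact (detRowAlternating (R := ℝ) (n := Fin k)).toMultilinearMap.map_smul_univ
          (fun j => u (f j) j) (fun j => u (f j))
  rw [h1, eq_inv_mul_iff_mul_eq₀ (by positivity)]
  have h2 : ∀ σ : Equiv.Perm (Fin k),
      ∑ f : Fin k → κ, (∏ j, u (f j) j) * (Matrix.of fun j l => u (f j) l).det =
      ∑ f : Fin k → κ, ((Equiv.Perm.sign σ : ℤ) : ℝ) * (∏ j, u (f (σ j)) j) *
        (Matrix.of fun j l => u (f j) l).det := by
    intro σ
    rw [← (Equiv.arrowCongr σ.symm (Equiv.refl κ)).sum_comp]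
    refine sum_congr rfl fun f _ => ?_
    have : (Matrix.of fun j l => u (f (σ j)) l).det =
        ((Equiv.Perm.sign σ : ℤ) : ℝ) * (Matrix.of fun j l => u (f j) l).det :=
      det_permute σ (Matrix.of fun j l => u (f j) l)
    simp only [Equiv.arrowCongr_apply, Equiv.symm_symm, Equiv.coe_refl, Function.comp_apply, id]
    rw [this]
    ring
  have h3 : (k.factorial : ℝ) * ∑ f : Fin k → κ, (∏ j, u (f j) j) *
      (Matrix.of fun j l => u (f j) l).det = ∑ σ : Equiv.Perm (Fin k),
      ∑ f : Fin k → κ, (∏ j, u (f j) j) * (Matrix.of fun j l => u (f j) l).det := by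
    rw [sum_const, card_univ, Fintype.card_perm, Fintype.card_fin, nsmul_eq_mul]
  rw [h3, sum_congr rfl fun σ _ => h2 σ, sum_comm]
  refine sum_congr rfl fun f _ => ?_
  rw [← sum_mul, sq]
  congr 1
  rw [det_apply']
  rfl

theorem det_sum_vecMulVec_eq_sum_embedding {k : ℕ} {κ : Type*} [Fintype κ] [DecidableEq κ]
    (u : κ → Fin k → ℝ) :
    (∑ i, vecMulVec (u i) (u i)).det =
      (k.factorial : ℝ)⁻¹ * ∑ f : Fin k ↪ κ, (Matrix.of fun j l => u (f j) l).det ^ 2 := by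
  rw [det_sum_vecMulVec]
  congr 1
  symm
  refine sum_of_injOn (fun f => (f : Fin k → κ)) DFunLike.coe_injective.injOn (by simp) ?_
    fun _ _ => rfl
  intro f _ hf
  have hnot : ¬ Function.Injective f := fun h => hf ⟨⟨f, h⟩, by simp, rfl⟩
  obtain ⟨i, j, hij, hne⟩ := Function.not_injective_iff.1 hnot
  rw [det_zero_of_row_eq hne (by ext l; simp [hij]), zero_pow two_ne_zero]

theorem exists_sum_equiv_of_embedding {k n : ℕ} (f : Fin k ↪ Fin n) :
    ∃ e : Fin k ⊕ Fin (n - k) ≃ Fin n, ∀ j, e (Sum.inl j) = f j := by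
  classical
  have hc : Fintype.card ((Set.range f)ᶜ : Set (Fin n)) = n - k := by
    rw [Fintype.card_compl_set, Fintype.card_fin, Set.card_range_of_injective f.injective,
      Fintype.card_fin]
  refine ⟨(Equiv.sumCongr (Equiv.ofInjective f f.injective)
    (Fintype.equivFinOfCardEq hc).symm).trans (Equiv.Set.sumCompl (Set.range f)), fun j => ?_⟩
  simp

section

variable {𝓨 : Type*} [MeasurableSpace 𝓨]

theorem IsONB.integrable_mul {m : ℕ} {ν : Measure 𝓨} {ψ : Fin m → 𝓨 → ℝ}
    (hψ : ∀ j, Measurable (ψ j)) (h : IsONB ν ψ) (i j : Fin m) :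
    Integrable (fun y => ψ i y * ψ j y) ν := by
  have h2 : ∀ i, MemLp (ψ i) 2 ν := fun i => by
    rw [memLp_two_iff_integrable_sq (hψ i).aestronglyMeasurable]
    by_contra hn
    have h1 := h i i
    rw [if_pos rfl, integral_undef (by simpa only [sq] using hn)] at h1
    exact zero_ne_one h1
  exact (h2 i).integrable_mul (h2 j)

theorem IsONB.comp_injective {m k : ℕ} {ν : Measure 𝓨} {ψ : Fin m → 𝓨 → ℝ} (h : IsONB ν ψ)
    {ι : Fin k → Fin m} (hι : Function.Injective ι) : IsONB ν fun j => ψ (ι j) := fun i j => by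
  rw [h (ι i) (ι j)]
  simp [hι.eq_iff]

theorem measurable_det {κ : Type*} {k : ℕ} [MeasurableSpace κ]
    {M : κ → Matrix (Fin k) (Fin k) ℝ} (hM : ∀ i j, Measurable fun x => M x i j) :
    Measurable fun x => (M x).det := by
  simp only [det_apply']
  fun_prop

theorem lintegral_det_sq {k : ℕ} {ν : Measure 𝓨} [IsProbabilityMeasure ν] {ψ : Fin k → 𝓨 → ℝ}
    (hψ : ∀ j, Measurable (ψ j)) (h : IsONB ν ψ) :
    ∫⁻ x : Fin k → 𝓨, ENNReal.ofReal ((Matrix.of fun j l => ψ l (x j)).det ^ 2)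
      ∂(Measure.pi fun _ => ν) = ENNReal.ofReal k.factorial := by
  have e : ∀ x : Fin k → 𝓨, (Matrix.of fun j l => ψ l (x j)).det ^ 2 =
      ∑ σ : Equiv.Perm (Fin k), ∑ τ : Equiv.Perm (Fin k),
        (((Equiv.Perm.sign σ : ℤ) : ℝ) * ((Equiv.Perm.sign τ : ℤ) : ℝ)) *
          ∏ i, ψ (σ i) (x i) * ψ (τ i) (x i) := fun x => by
    rw [← det_transpose, det_apply', sq, sum_mul_sum]
    refine sum_congr rfl fun σ _ => sum_congr rfl fun τ _ => ?_
    rw [prod_mul_distrib]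
    simp only [transpose_apply, of_apply]
    ring
  have hinteg : ∀ σ τ : Equiv.Perm (Fin k), Integrable (fun x : Fin k → 𝓨 =>
      (((Equiv.Perm.sign σ : ℤ) : ℝ) * ((Equiv.Perm.sign τ : ℤ) : ℝ)) *
          ∏ i, ψ (σ i) (x i) * ψ (τ i) (x i)) (Measure.pi fun _ => ν) := fun σ τ =>
    (Integrable.fintype_prod (f := fun i y => ψ (σ i) y * ψ (τ i) y)
      fun i => h.integrable_mul hψ (σ i) (τ i)).const_mul _
  rw [← ofReal_integral_eq_lintegral_ofReal]
  · congr 1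
    simp only [e]
    rw [integral_finsetSum _ fun σ _ => integrable_finsetSum _ fun τ _ => hinteg σ τ]
    have : ∀ σ : Equiv.Perm (Fin k), ∫ x : Fin k → 𝓨, ∑ τ : Equiv.Perm (Fin k),
        (((Equiv.Perm.sign σ : ℤ) : ℝ) * ((Equiv.Perm.sign τ : ℤ) : ℝ)) *
          ∏ i, ψ (σ i) (x i) * ψ (τ i) (x i) ∂(Measure.pi fun _ => ν) = 1 := fun σ => by
      rw [integral_finsetSum _ fun τ _ => hinteg σ τ, sum_eq_single σ]
      · rw [integral_const_mul, integral_fintype_prod_eq_prod (f := fun i y => ψ (σ i) y * ψ (σ i) y)]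
        simp only [h (σ _) (σ _), if_pos, prod_const_one, mul_one]
        exact_mod_cast Int.units_coe_mul_self _
      · intro τ _ hτ
        obtain ⟨i, hi⟩ : ∃ i, τ i ≠ σ i := by
          by_contra! hn
          exact hτ (Equiv.ext hn)
        rw [integral_const_mul, integral_fintype_prod_eq_prod (f := fun i y => ψ (σ i) y * ψ (τ i) y),
          prod_eq_zero (mem_univ i), mul_zero]
        rw [h, if_neg hi.symm]
      · simp
    rw [sum_congr rfl fun σ _ => this σ]
    simp [Fintype.card_perm]
  · simp only [e]
    exact integrable_finsetSum _ fun σ _ => integrable_finsetSum _ fun τ _ => hinteg σ τ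
  · exact Filter.Eventually.of_forall fun x => sq_nonneg _

theorem measurePreserving_comp_sum {κ κ₁ κ₂ : Type*} [Fintype κ] [Fintype κ₁] [Fintype κ₂]
    (ν : Measure 𝓨) [IsProbabilityMeasure ν] (e : κ₁ ⊕ κ₂ ≃ κ) :
    MeasurePreserving (fun x : κ → 𝓨 => (fun i => x (e (Sum.inl i)), fun i => x (e (Sum.inr i))))
      (Measure.pi fun _ => ν) ((Measure.pi fun _ => ν).prod (Measure.pi fun _ => ν)) := by
  have h1 := measurePreserving_sumPiEquivProdPi (X := fun _ : κ₁ ⊕ κ₂ => 𝓨) fun _ => ν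
  have h2 := (measurePreserving_piCongrLeft (α := fun _ : κ => 𝓨) (fun _ => ν) e).symm
  exact h1.comp h2

theorem lintegral_det_mul_le {k n : ℕ} {ν : Measure 𝓨} [IsProbabilityMeasure ν]
    {ψ : Fin k → 𝓨 → ℝ} (hψ : ∀ j, Measurable (ψ j)) (h : IsONB ν ψ)
    {E : (Fin n → 𝓨) → ℝ≥0∞} {F : (Fin (n - k) → 𝓨) → ℝ≥0∞} (hF : Measurable F)
    (hEF : ∀ (x : Fin n → 𝓨) (g : Fin (n - k) ↪ Fin n), E x ≤ F fun i => x (g i)) :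
    ∫⁻ x : Fin n → 𝓨, ENNReal.ofReal
        (∑ i, vecMulVec (fun j => ψ j (x i)) (fun j => ψ j (x i))).det * E x
        ∂(Measure.pi fun _ => ν) ≤
      n.descFactorial k * ∫⁻ z, F z ∂(Measure.pi fun _ => ν) := by
  choose e he using fun f : Fin k ↪ Fin n => exists_sum_equiv_of_embedding f
  have hmeas : Measurable fun y : Fin k → 𝓨 =>
      ENNReal.ofReal ((Matrix.of fun j l => ψ l (y j)).det ^ 2) := by
    refine ((measurable_det fun i j => ?_).pow_const 2).ennreal_ofReal
    exact (hψ j).comp (measurable_pi_apply i)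
  have hpt : ∀ x : Fin n → 𝓨, ENNReal.ofReal
        (∑ i, vecMulVec (fun j => ψ j (x i)) (fun j => ψ j (x i))).det * E x ≤
      ENNReal.ofReal (k.factorial : ℝ)⁻¹ * ∑ f : Fin k ↪ Fin n,
        ENNReal.ofReal ((Matrix.of fun j l => ψ l (x (e f (Sum.inl j)))).det ^ 2) *
          F fun i => x (e f (Sum.inr i)) := fun x => by
    rw [det_sum_vecMulVec_eq_sum_embedding, ENNReal.ofReal_mul (by positivity),
      ENNReal.ofReal_sum_of_nonneg fun f _ => sq_nonneg _, mul_assoc, sum_mul]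
    refine mul_le_mul' le_rfl (sum_le_sum fun f _ => mul_le_mul' (le_of_eq ?_) ?_)
    · simp only [he]
    · exact hEF x ⟨fun i => e f (Sum.inr i), (e f).injective.comp Sum.inr_injective⟩
  have hterm : ∀ f : Fin k ↪ Fin n, ∫⁻ x : Fin n → 𝓨,
      ENNReal.ofReal ((Matrix.of fun j l => ψ l (x (e f (Sum.inl j)))).det ^ 2) *
          F (fun i => x (e f (Sum.inr i))) ∂(Measure.pi fun _ => ν) =
      ENNReal.ofReal k.factorial * ∫⁻ z, F z ∂(Measure.pi fun _ => ν) := fun f => by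
    rw [← lintegral_det_sq hψ h, ← lintegral_prod_mul hmeas.aemeasurable hF.aemeasurable]
    exact (measurePreserving_comp_sum ν (e f)).lintegral_comp
      (f := fun p : (Fin k → 𝓨) × (Fin (n - k) → 𝓨) =>
        ENNReal.ofReal ((Matrix.of fun j l => ψ l (p.1 j)).det ^ 2) * F p.2)
      ((hmeas.comp measurable_fst).mul (hF.comp measurable_snd))
  refine (lintegral_mono hpt).trans ?_
  rw [lintegral_const_mul' _ _ ENNReal.ofReal_ne_top, lintegral_finsetSum']
  · rw [sum_congr rfl fun f _ => hterm f, sum_const, card_univ, Fintype.card_embedding_eq,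
      Fintype.card_fin, Fintype.card_fin, nsmul_eq_mul, mul_left_comm, ← mul_assoc (ENNReal.ofReal _),
      ← ENNReal.ofReal_mul (by positivity), inv_mul_cancel₀ (by positivity), ENNReal.ofReal_one,
      one_mul]
  · intro f _
    exact (((hmeas.comp measurable_fst).mul (hF.comp measurable_snd)).comp
      (measurePreserving_comp_sum ν (e f)).measurable).aemeasurable

end

section

variable {𝓨 : Type*} [MeasurableSpace 𝓨]

theorem isSymm_sum_vecMulVec {ι κ : Type*} [Fintype ι] (s : Finset κ) (v : κ → ι → ℝ) :
    (∑ i ∈ s, vecMulVec (v i) (v i)).IsSymm := by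
  rw [IsSymm, transpose_sum]
  simp only [transpose_vecMulVec]

theorem measurable_trace_exp {κ : Type*} {m : ℕ} [MeasurableSpace κ]
    {M : κ → Matrix (Fin m) (Fin m) ℝ} (hM : ∀ i j, Measurable fun x => M x i j) (θ : ℝ) :
    Measurable fun x => trace (NormedSpace.exp (-θ • M x)) := by
  have hc : Continuous fun A : Fin m → Fin m → ℝ =>
      trace (NormedSpace.exp (-θ • (Matrix.of A : Matrix (Fin m) (Fin m) ℝ))) :=
    (continuous_matrix_exp.comp (continuous_id.const_smul (-θ))).matrix_trace
  exact hc.measurable.comp (measurable_pi_lambda _ fun i => measurable_pi_lambda _ fun j => hM i j)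

theorem integral_quadraticForm {m : ℕ} {ν : Measure 𝓨} {ψ : Fin m → 𝓨 → ℝ}
    (hψ : ∀ j, Measurable (ψ j)) (h : IsONB ν ψ) (P : Matrix (Fin m) (Fin m) ℝ) :
    Integrable (fun y => (fun j => ψ j y) ⬝ᵥ P *ᵥ fun j => ψ j y) ν ∧
      ∫ y, (fun j => ψ j y) ⬝ᵥ P *ᵥ (fun j => ψ j y) ∂ν = P.trace := by
  have e : ∀ y, (fun j => ψ j y) ⬝ᵥ P *ᵥ (fun j => ψ j y) =
      ∑ i, ∑ j, P i j * (ψ i y * ψ j y) := fun y => by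
    simp only [dotProduct, mulVec, mul_sum]
    exact sum_congr rfl fun i _ => sum_congr rfl fun j _ => by ring
  have hinteg : ∀ i j, Integrable (fun y => P i j * (ψ i y * ψ j y)) ν := fun i j =>
    (h.integrable_mul hψ i j).const_mul _
  simp only [e]
  refine ⟨integrable_finsetSum _ fun i _ => integrable_finsetSum _ fun j _ => hinteg i j, ?_⟩
  rw [integral_finsetSum _ fun i _ => integrable_finsetSum _ fun j _ => hinteg i j]
  refine sum_congr rfl fun i _ => ?_
  rw [integral_finsetSum _ fun j _ => hinteg i j]
  simp only [integral_const_mul, h i _, mul_ite, mul_one, mul_zero, sum_ite_eq, mem_univ, if_true,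
    diag_apply]

theorem lintegral_trace_exp_add_le {m : ℕ} {ν : Measure 𝓨} [IsProbabilityMeasure ν]
    {ψ : Fin m → 𝓨 → ℝ} (hψ : ∀ j, Measurable (ψ j)) (h : IsONB ν ψ) {R θ : ℝ} (hR : 0 < R)
    (hψR : ∀ᵐ y ∂ν, (fun j => ψ j y) ⬝ᵥ (fun j => ψ j y) ≤ R)
    {S : Matrix (Fin m) (Fin m) ℝ} (hS : S.IsSymm) :
    ∫⁻ y, ENNReal.ofReal (trace (NormedSpace.exp
        (-θ • (S + vecMulVec (fun j => ψ j y) (fun j => ψ j y))))) ∂ν ≤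
      ENNReal.ofReal ((1 - (1 - Real.exp (-(θ * R))) / R) * trace (NormedSpace.exp (-θ • S))) := by
  obtain ⟨hinteg, hval⟩ := integral_quadraticForm hψ h (NormedSpace.exp (-θ • S))
  have hle : ∀ᵐ y ∂ν, trace (NormedSpace.exp
        (-θ • (S + vecMulVec (fun j => ψ j y) (fun j => ψ j y)))) ≤
      trace (NormedSpace.exp (-θ • S)) - (1 - Real.exp (-(θ * R))) / R *
        ((fun j => ψ j y) ⬝ᵥ NormedSpace.exp (-θ • S) *ᵥ fun j => ψ j y) := by
    filter_upwards [hψR] with y hy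
    exact trace_exp_add_vecMulVec_le hS hR hy
  have hnn : ∀ y, 0 ≤ trace (NormedSpace.exp
        (-θ • (S + vecMulVec (fun j => ψ j y) (fun j => ψ j y)))) := fun y => by
    have hX : (vecMulVec (fun j => ψ j y) (fun j => ψ j y)).IsSymm := transpose_vecMulVec _ _
    exact (posSemidef_exp ((hS.add hX).smul (-θ))).trace_nonneg
  refine (lintegral_mono_ae (hle.mono fun y hy => ENNReal.ofReal_le_ofReal hy)).trans ?_
  rw [← ofReal_integral_eq_lintegral_ofReal]
  · rw [integral_sub (integrable_const _) (hinteg.const_mul _), integral_const_mul, hval]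
    simp only [integral_const, probReal_univ, one_smul]
    exact ENNReal.ofReal_le_ofReal (le_of_eq (by ring))
  · exact (integrable_const _).sub (hinteg.const_mul _)
  · exact hle.mono fun y hy => (hnn y).trans hy

theorem lintegral_pi_succ (ν : Measure 𝓨) [IsProbabilityMeasure ν] {N : ℕ}
    {T : 𝓨 × (Fin N → 𝓨) → ℝ≥0∞} (hT : Measurable T) :
    ∫⁻ x : Fin (N + 1) → 𝓨, T (x 0, fun i => x i.succ) ∂(Measure.pi fun _ => ν) =
      ∫⁻ z, ∫⁻ y, T (y, z) ∂ν ∂(Measure.pi fun _ => ν) := by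
  rw [← lintegral_prod_symm _ hT.aemeasurable]
  exact (measurePreserving_piFinSuccAbove (α := fun _ : Fin (N + 1) => 𝓨)
    (fun _ => ν) 0).lintegral_comp hT

theorem lintegral_trace_exp_sum_le {m : ℕ} {ν : Measure 𝓨} [IsProbabilityMeasure ν]
    {ψ : Fin m → 𝓨 → ℝ} (hψ : ∀ j, Measurable (ψ j)) (h : IsONB ν ψ) {R θ : ℝ} (hR : 0 < R)
    (hψR : ∀ᵐ y ∂ν, (fun j => ψ j y) ⬝ᵥ (fun j => ψ j y) ≤ R)
    (hq : 0 ≤ 1 - (1 - Real.exp (-(θ * R))) / R) (N : ℕ) :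
    ∫⁻ x : Fin N → 𝓨, ENNReal.ofReal (trace (NormedSpace.exp
        (-θ • ∑ i, vecMulVec (fun j => ψ j (x i)) (fun j => ψ j (x i)))))
        ∂(Measure.pi fun _ => ν) ≤
      ENNReal.ofReal ((1 - (1 - Real.exp (-(θ * R))) / R) ^ N * m) := by
  induction N with
  | zero => simp
  | succ N ih =>
    have hmeas : Measurable fun p : 𝓨 × (Fin N → 𝓨) => ENNReal.ofReal (trace (NormedSpace.exp
        (-θ • ((∑ i, vecMulVec (fun j => ψ j (p.2 i)) (fun j => ψ j (p.2 i))) +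
          vecMulVec (fun j => ψ j p.1) (fun j => ψ j p.1))))) := by
      refine (measurable_trace_exp (fun i j => ?_) θ).ennreal_ofReal
      simp only [Matrix.add_apply, Matrix.sum_apply, vecMulVec_apply]
      fun_prop
    simp only [Fin.sum_univ_succ, add_comm (vecMulVec _ _)]
    rw [lintegral_pi_succ ν hmeas]
    have hstep : ∀ z : Fin N → 𝓨, ∫⁻ y, ENNReal.ofReal (trace (NormedSpace.exp
        (-θ • ((∑ i, vecMulVec (fun j => ψ j (z i)) (fun j => ψ j (z i))) +
          vecMulVec (fun j => ψ j y) (fun j => ψ j y))))) ∂ν ≤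
        ENNReal.ofReal (1 - (1 - Real.exp (-(θ * R))) / R) *
          ENNReal.ofReal (trace (NormedSpace.exp
            (-θ • ∑ i, vecMulVec (fun j => ψ j (z i)) (fun j => ψ j (z i))))) := fun z => by
      rw [← ENNReal.ofReal_mul hq]
      exact lintegral_trace_exp_add_le hψ h hR hψR (isSymm_sum_vecMulVec univ _)
    refine (lintegral_mono hstep).trans ?_
    rw [lintegral_const_mul' _ _ ENNReal.ofReal_ne_top, pow_succ', mul_assoc,
      ENNReal.ofReal_mul hq]
    gcongr

theorem lintegral_det_mul_trace_exp_le {m k n : ℕ} (hk : k ≤ m) (hmn : m ≤ n) {ν : Measure 𝓨}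
    [IsProbabilityMeasure ν] {ψ : Fin m → 𝓨 → ℝ} (hψ : ∀ j, Measurable (ψ j)) (h : IsONB ν ψ)
    {ι : Fin k → Fin m} (hι : Function.Injective ι) {R θ : ℝ} (hR : 1 ≤ R) (hθ : 0 ≤ θ)
    (hψR : ∀ᵐ y ∂ν, (fun j => ψ j y) ⬝ᵥ (fun j => ψ j y) ≤ R) :
    ∫⁻ x : Fin n → 𝓨, ENNReal.ofReal
        (∑ i, vecMulVec (fun j => ψ (ι j) (x i)) (fun j => ψ (ι j) (x i))).det *
        ENNReal.ofReal (trace (NormedSpace.exp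
          (-θ • ∑ i, vecMulVec (fun j => ψ j (x i)) (fun j => ψ j (x i)))))
        ∂(Measure.pi fun _ => ν) ≤
      n.descFactorial k *
        ENNReal.ofReal ((1 - (1 - Real.exp (-(θ * R))) / R) ^ (n - m) * m) := by
  have hR0 : 0 < R := by linarith
  have hexp : Real.exp (-(θ * R)) ≤ 1 := Real.exp_le_one_iff.2 (by nlinarith)
  have hq1 : 1 - (1 - Real.exp (-(θ * R))) / R ≤ 1 := by
    rw [sub_le_self_iff]
    exact div_nonneg (by linarith) hR0.le
  have hq0 : 0 ≤ 1 - (1 - Real.exp (-(θ * R))) / R := by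
    rw [sub_nonneg, div_le_one hR0]
    linarith [Real.exp_pos (-(θ * R))]
  refine (lintegral_det_mul_le (F := fun z : Fin (n - k) → 𝓨 => ENNReal.ofReal (trace
    (NormedSpace.exp (-θ • ∑ i, vecMulVec (fun j => ψ j (z i)) (fun j => ψ j (z i))))))
    (fun j => hψ (ι j)) (h.comp_injective hι) ?_ fun x g => ?_).trans ?_
  · refine (measurable_trace_exp (fun i j => ?_) θ).ennreal_ofReal
    simp only [Matrix.sum_apply, vecMulVec_apply]
    fun_prop
  · refine ENNReal.ofReal_le_ofReal ?_
    have hsplit := sum_add_sum_compl (univ.map g)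
      fun i => vecMulVec (fun j => ψ j (x i)) (fun j => ψ j (x i))
    rw [sum_map] at hsplit
    rw [← hsplit]
    exact trace_exp_add_sum_le (isSymm_sum_vecMulVec _ _) _ _ hθ
  · gcongr
    refine (lintegral_trace_exp_sum_le hψ h hR0 hψR hq0 (n - k)).trans ?_
    refine ENNReal.ofReal_le_ofReal ?_
    gcongr ?_ * _
    exact pow_le_pow_of_le_one hq0 hq1 (by omega)

end

section

variable {𝓨 : Type*}

/-- The functions `w^{-1/2} φ_j`, orthonormal for `wμ` when the `φ_j` are orthonormal for `μ`. -/
def scaled {m : ℕ} (φ : Fin m → 𝓨 → ℝ) (w : 𝓨 → ℝ) : Fin m → 𝓨 → ℝ :=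
  fun j y => (Real.sqrt (w y))⁻¹ * φ j y

/-- The sum of the outer products `ψ(x_i) ψ(x_i)ᵀ`. -/
def outerSum {m n : ℕ} (ψ : Fin m → 𝓨 → ℝ) (x : Fin n → 𝓨) : Matrix (Fin m) (Fin m) ℝ :=
  ∑ i, vecMulVec (fun j => ψ j (x i)) (fun j => ψ j (x i))

theorem posSemidef_outerSum {m n : ℕ} (ψ : Fin m → 𝓨 → ℝ) (x : Fin n → 𝓨) :
    (outerSum ψ x).PosSemidef :=
  posSemidef_sum _ fun i _ => posSemidef_vecMulVec_self_star fun j => ψ j (x i)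

theorem scaled_mul_scaled {m : ℕ} (φ : Fin m → 𝓨 → ℝ) {w : 𝓨 → ℝ} {y : 𝓨} (hw : 0 < w y)
    (i j : Fin m) : scaled φ w i y * scaled φ w j y = (w y)⁻¹ * (φ i y * φ j y) := by
  have h : (Real.sqrt (w y))⁻¹ * (Real.sqrt (w y))⁻¹ = (w y)⁻¹ := by
    rw [← mul_inv, Real.mul_self_sqrt hw.le]
  rw [scaled, ← h]
  simp only [scaled]
  ring

theorem gram_eq_smul_outerSum {m n : ℕ} (φ : Fin m → 𝓨 → ℝ) {w : 𝓨 → ℝ} (hw : ∀ y, 0 < w y)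
    (x : Fin n → 𝓨) : gram φ w x = (n : ℝ)⁻¹ • outerSum (scaled φ w) x := by
  rw [gram, outerSum]
  congr 1
  refine sum_congr rfl fun i _ => ?_
  ext j l
  rw [vecMulVec_apply, scaled_mul_scaled φ (hw _)]
  rfl

variable [MeasurableSpace 𝓨]

theorem measurable_scaled {m : ℕ} {φ : Fin m → 𝓨 → ℝ} {w : 𝓨 → ℝ} (hφ : ∀ j, Measurable (φ j))
    (hw : Measurable w) (j : Fin m) : Measurable (scaled φ w j) :=
  hw.sqrt.inv.mul (hφ j)

theorem isProbabilityMeasure_dens {μ : Measure 𝓨} {w : 𝓨 → ℝ} (hw : ∀ y, 0 < w y)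
    (hinteg : ∫ y, w y ∂μ = 1) : IsProbabilityMeasure (dens μ w) := by
  constructor
  have hi : Integrable w μ := by
    by_contra hn
    rw [integral_undef hn] at hinteg
    exact zero_ne_one hinteg
  rw [dens, withDensity_apply _ MeasurableSet.univ, setLIntegral_univ,
    ← ofReal_integral_eq_lintegral_ofReal hi (Filter.Eventually.of_forall fun y => (hw y).le), hinteg,
    ENNReal.ofReal_one]

theorem isONB_scaled {m : ℕ} {μ : Measure 𝓨} {φ : Fin m → 𝓨 → ℝ} (horth : IsONB μ φ)
    {w : 𝓨 → ℝ} (hwpos : ∀ y, 0 < w y) (hw : Measurable w) :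
    IsONB (dens μ w) (scaled φ w) := fun i j => by
  have h := integral_withDensity_eq_integral_smul (μ := μ) hw.real_toNNReal
    (fun y => scaled φ w i y * scaled φ w j y)
  refine h.trans (Eq.trans (integral_congr_ae (Filter.Eventually.of_forall fun y => ?_)) (horth i j))
  simp only [NNReal.smul_def, Real.coe_toNNReal _ (hwpos y).le, smul_eq_mul,
    scaled_mul_scaled φ (hwpos y)]
  rw [mul_inv_cancel_left₀ (hwpos y).ne']

theorem ae_scaled_dotProduct_le {m : ℕ} (hm : 0 < m) {μ : Measure 𝓨} {φ : Fin m → 𝓨 → ℝ}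
    {w : 𝓨 → ℝ} (hwpos : ∀ y, 0 < w y) {α : ℝ} (hα : 0 < α)
    (hwm : ∀ᵐ y ∂μ, α * wChr φ y ≤ w y) :
    ∀ᵐ y ∂(dens μ w), (fun j => scaled φ w j y) ⬝ᵥ (fun j => scaled φ w j y) ≤ m / α := by
  refine (withDensity_absolutelyContinuous μ _).ae_le ?_
  filter_upwards [hwm] with y hy
  simp only [dotProduct, scaled_mul_scaled φ (hwpos y), ← mul_sum, ← sq]
  have hm' : (0 : ℝ) < m := by exact_mod_cast hm
  rw [wChr] at hy
  rw [inv_mul_le_iff₀ (hwpos y), mul_div_assoc', le_div_iff₀ hα]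
  have := mul_le_mul_of_nonneg_right hy hm'.le
  calc _ = α * ((m : ℝ)⁻¹ * ∑ i, φ i y ^ 2) * m := by field_simp
    _ ≤ _ := this

theorem card_le_of_ae_dotProduct_le {m : ℕ} {ν : Measure 𝓨} [IsProbabilityMeasure ν]
    {ψ : Fin m → 𝓨 → ℝ} (hψ : ∀ j, Measurable (ψ j)) (h : IsONB ν ψ) {R : ℝ}
    (hR : ∀ᵐ y ∂ν, (fun j => ψ j y) ⬝ᵥ (fun j => ψ j y) ≤ R) : (m : ℝ) ≤ R := by
  obtain ⟨h1, h2⟩ := integral_quadraticForm hψ h 1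
  simp only [one_mulVec, trace_one, Fintype.card_fin] at h1 h2
  rw [← h2]
  refine (integral_mono_ae h1 (integrable_const R) hR).trans (le_of_eq ?_)
  simp

theorem lintegral_vs_le {m n : ℕ} (hmn : m < n) (μ : Measure 𝓨) {φ : Fin m → 𝓨 → ℝ}
    (hφ : ∀ j, Measurable (φ j)) {w : 𝓨 → ℝ} (hwpos : ∀ y, 0 < w y) (hw : Measurable w)
    (E : (Fin n → 𝓨) → ℝ≥0∞) :
    ∫⁻ x, E x ∂(vs μ φ w n) ≤ (n.descFactorial m : ℝ≥0∞)⁻¹ *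
      ∫⁻ x : Fin n → 𝓨, ENNReal.ofReal (outerSum (scaled φ w) x).det * E x
        ∂(Measure.pi fun _ => dens μ w) := by
  have hn : (0 : ℝ) < n := by exact_mod_cast (Nat.zero_le m).trans_lt hmn
  have hd : 0 < n.descFactorial m := Nat.descFactorial_pos.2 hmn.le
  have hdens : ∀ x : Fin n → 𝓨, (n : ℝ) ^ m * ((n - m).factorial : ℝ) / (n.factorial : ℝ) *
      (gram φ w x).det = (n.descFactorial m : ℝ)⁻¹ * (outerSum (scaled φ w) x).det := fun x => by
    rw [gram_eq_smul_outerSum φ hwpos, det_smul, Fintype.card_fin,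
      ← Nat.factorial_mul_descFactorial hmn.le]
    push_cast
    rw [inv_pow]
    field_simp
  rw [vs]
  simp only [hdens]
  refine (lintegral_withDensity_le_lintegral_mul _ ?_ _).trans (le_of_eq ?_)
  · refine ((measurable_det fun i j => ?_).const_mul _).ennreal_ofReal
    simp only [outerSum, Matrix.sum_apply, vecMulVec_apply]
    have := measurable_scaled hφ hw
    fun_prop
  · rw [← lintegral_const_mul' _ _ (by simp [hd.ne'])]
    refine lintegral_congr fun x => ?_
    rw [Pi.mul_apply, ENNReal.ofReal_mul (by positivity), mul_assoc,
      ENNReal.ofReal_inv_of_pos (by exact_mod_cast hd), ENNReal.ofReal_natCast]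

theorem cDelta_pos {δ : ℝ} (hδ0 : 0 < δ) (hδ1 : δ < 1) : 0 < cDelta δ := by
  have h0 : 0 < 1 - δ := by linarith
  have h := Real.log_lt_sub_one_of_pos (inv_pos.2 h0)
    fun h => by linarith [inv_eq_one.1 h]
  rw [Real.log_inv] at h
  have h2 := mul_lt_mul_of_pos_left h h0
  rw [mul_sub, mul_inv_cancel₀ h0.ne'] at h2
  rw [cDelta]
  linarith

/-- The Chernoff parameter for matrices bounded by `R`. -/
def chernoffParam (R δ : ℝ) : ℝ := -Real.log (1 - δ) / R

theorem chernoffParam_nonneg {R δ : ℝ} (hR : 0 < R) (hδ0 : 0 < δ) (hδ1 : δ < 1) :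
    0 ≤ chernoffParam R δ :=
  div_nonneg (neg_nonneg.2 (Real.log_nonpos (by linarith) (by linarith))) hR.le

theorem chernoff_bound {R δ : ℝ} (hR : 1 ≤ R) (hδ1 : δ < 1) (N : ℕ) :
    Real.exp (chernoffParam R δ * ((1 - δ) * N)) *
      (1 - (1 - Real.exp (-(chernoffParam R δ * R))) / R) ^ N ≤
      Real.exp (-(cDelta δ * N) / R) := by
  have hR0 : 0 < R := by linarith
  have e1 : Real.exp (-(chernoffParam R δ * R)) = 1 - δ := by
    rw [chernoffParam, div_mul_cancel₀ _ hR0.ne', neg_neg, Real.exp_log (by linarith)]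
  have h1 : 1 - δ / R ≤ Real.exp (-(δ / R)) := by
    linarith [Real.add_one_le_exp (-(δ / R))]
  have h0 : 0 ≤ 1 - δ / R := by
    rw [sub_nonneg, div_le_one hR0]; linarith
  rw [e1, sub_sub_cancel]
  calc _ ≤ Real.exp (chernoffParam R δ * ((1 - δ) * N)) * Real.exp (-(δ / R)) ^ N := by gcongr
    _ = _ := by
      rw [← Real.exp_nat_mul, ← Real.exp_add, chernoffParam, cDelta]
      congr 1
      field_simp
      ring

theorem one_le_exp_mul_trace_exp_of_lt {m n : ℕ} (hm : 0 < m) (hn : 0 < n) {δ s : ℝ} (hs : 0 < s)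
    (hδ1 : δ < 1) {A : Matrix (Fin m) (Fin m) ℝ} (hA : A.IsSymm) {θ : ℝ} (hθ : 0 ≤ θ)
    (h : (1 - δ)⁻¹ * ((n : ℝ) / s) < (lambdaMin ((n : ℝ)⁻¹ • A))⁻¹) :
    1 ≤ Real.exp (θ * ((1 - δ) * s)) * trace (NormedSpace.exp (-θ • A)) := by
  have hn' : (0 : ℝ) < n := by exact_mod_cast hn
  have h0 : 0 < 1 - δ := by linarith
  have hle : lambdaMin ((n : ℝ)⁻¹ • A) ≤ (1 - δ) * s / n := by
    have h2 := inv_anti₀ (by positivity) h.le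
    rw [inv_inv] at h2
    refine h2.trans (le_of_eq ?_)
    field_simp
  have h3 := one_le_exp_mul_trace_exp hm (hA.smul (n : ℝ)⁻¹) (θ := θ * n) (by positivity) hle
  have e1 : θ * n * ((1 - δ) * s / n) = θ * ((1 - δ) * s) := by field_simp
  have e2 : -(θ * n) • (n : ℝ)⁻¹ • A = -θ • A := by
    rw [smul_smul]
    congr 1
    field_simp
  rwa [e1, e2] at h3

/-- An exponential moment which dominates the indicator of the event that `λ_min` is small. -/
def tailBound {m n : ℕ} (ψ : Fin m → 𝓨 → ℝ) (R δ : ℝ) (x : Fin n → 𝓨) : ℝ≥0∞ :=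
  ENNReal.ofReal (Real.exp (chernoffParam R δ * ((1 - δ) * (n - m : ℕ)))) *
    ENNReal.ofReal (trace (NormedSpace.exp (-chernoffParam R δ • outerSum ψ x)))

theorem lintegral_det_mul_tailBound_le {m k n : ℕ} (hk : k ≤ m) (hmn : m ≤ n) {ν : Measure 𝓨}
    [IsProbabilityMeasure ν] {ψ : Fin m → 𝓨 → ℝ} (hψ : ∀ j, Measurable (ψ j)) (h : IsONB ν ψ)
    {ι : Fin k → Fin m} (hι : Function.Injective ι) {R δ : ℝ} (hR : 1 ≤ R)
    (hδ0 : 0 < δ) (hδ1 : δ < 1)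
    (hψR : ∀ᵐ y ∂ν, (fun j => ψ j y) ⬝ᵥ (fun j => ψ j y) ≤ R) :
    ∫⁻ x : Fin n → 𝓨, ENNReal.ofReal (outerSum (fun j => ψ (ι j)) x).det * tailBound ψ R δ x
        ∂(Measure.pi fun _ => ν) ≤
      n.descFactorial k * ENNReal.ofReal (m * Real.exp (-(cDelta δ * (n - m : ℕ)) / R)) := by
  have hθ := chernoffParam_nonneg (by linarith : 0 < R) hδ0 hδ1
  simp only [tailBound, mul_left_comm (ENNReal.ofReal (det _))]
  rw [lintegral_const_mul' _ _ ENNReal.ofReal_ne_top]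
  refine (mul_le_mul' le_rfl (lintegral_det_mul_trace_exp_le hk hmn hψ h hι hR hθ hψR)).trans ?_
  rw [mul_left_comm, ← ENNReal.ofReal_mul (Real.exp_pos _).le, ← mul_assoc, mul_comm (m : ℝ)]
  gcongr
  exact chernoff_bound hR hδ1 _

end

section

variable {𝓨 : Type*}

theorem det_outerSum_nonneg {m n : ℕ} (ψ : Fin m → 𝓨 → ℝ) (x : Fin n → 𝓨) :
    0 ≤ (outerSum ψ x).det :=
  (posSemidef_outerSum ψ x).det_nonneg

theorem det_outerSum_mul_inv_lambdaMin_le {m n : ℕ} (hn : 0 < n) (ψ : Fin (m + 1) → 𝓨 → ℝ)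
    (x : Fin n → 𝓨) :
    (outerSum ψ x).det * (lambdaMin ((n : ℝ)⁻¹ • outerSum ψ x))⁻¹ ≤
      n * ∑ j : Fin (m + 1), (outerSum (fun i => ψ (j.succAbove i)) x).det := by
  have hn' : (0 : ℝ) < n := by exact_mod_cast hn
  have h := inv_lambdaMin_mul_det_le
    ((posSemidef_outerSum ψ x).smul (inv_nonneg.2 hn'.le : 0 ≤ (n : ℝ)⁻¹))
  have htr : (outerSum ψ x).adjugate.trace =
      ∑ j : Fin (m + 1), (outerSum (fun i => ψ (j.succAbove i)) x).det := by
    refine sum_congr rfl fun j _ => ?_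
    rw [diag_apply, adjugate_fin_succ_eq_det_submatrix, ← two_mul, pow_mul, neg_one_sq, one_pow,
      one_mul]
    congr 1
    ext a b
    simp [outerSum, Matrix.sum_apply, vecMulVec_apply]
  rw [det_smul, adjugate_smul, trace_smul, htr, Fintype.card_fin, Nat.add_sub_cancel, smul_eq_mul,
    pow_succ, mul_left_comm, mul_assoc] at h
  have h2 := le_of_mul_le_mul_left h (by positivity)
  rw [mul_comm (outerSum ψ x).det]
  rwa [inv_mul_le_iff₀ hn'] at h2

theorem one_le_tailBound {m n : ℕ} (hm : 0 < m) (hmn : m < n) {R δ : ℝ} (hR : 0 < R) (hδ0 : 0 < δ)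
    (hδ1 : δ < 1) (ψ : Fin m → 𝓨 → ℝ) (x : Fin n → 𝓨)
    (h : (1 - δ)⁻¹ * ((n : ℝ) / ((n : ℝ) - m)) < (lambdaMin ((n : ℝ)⁻¹ • outerSum ψ x))⁻¹) :
    1 ≤ tailBound ψ R δ x := by
  rw [← Nat.cast_sub hmn.le] at h
  have h1 := one_le_exp_mul_trace_exp_of_lt hm (hm.trans hmn) (by exact_mod_cast Nat.sub_pos_of_lt hmn)
    hδ1 (isSymm_sum_vecMulVec _ _) (chernoffParam_nonneg hR hδ0 hδ1) h
  rw [tailBound, ← ENNReal.ofReal_mul (Real.exp_pos _).le]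
  exact ENNReal.one_le_ofReal.2 h1

theorem ofReal_det_mul_ofReal_inv_lambdaMin_le {m n : ℕ} (hmn : m + 1 < n) {R δ : ℝ} (hR : 0 < R)
    (hδ0 : 0 < δ) (hδ1 : δ < 1) (ψ : Fin (m + 1) → 𝓨 → ℝ) (x : Fin n → 𝓨) :
    ENNReal.ofReal (outerSum ψ x).det *
        ENNReal.ofReal (lambdaMin ((n : ℝ)⁻¹ • outerSum ψ x))⁻¹ ≤
      ENNReal.ofReal ((1 - δ)⁻¹ * ((n : ℝ) / ((n : ℝ) - (m + 1 : ℕ)))) *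
          (ENNReal.ofReal (outerSum ψ x).det * 1) +
        n * ∑ j : Fin (m + 1), ENNReal.ofReal (outerSum (fun i => ψ (j.succAbove i)) x).det *
          tailBound ψ R δ x := by
  by_cases h : (1 - δ)⁻¹ * ((n : ℝ) / ((n : ℝ) - (m + 1 : ℕ))) <
    (lambdaMin ((n : ℝ)⁻¹ • outerSum ψ x))⁻¹
  · have h1 := one_le_tailBound m.succ_pos hmn hR hδ0 hδ1 ψ x h
    refine le_add_left ?_
    rw [← ENNReal.ofReal_mul (det_outerSum_nonneg ψ x)]
    refine (ENNReal.ofReal_le_ofReal (det_outerSum_mul_inv_lambdaMin_le (by omega) ψ x)).trans ?_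
    rw [ENNReal.ofReal_mul n.cast_nonneg, ENNReal.ofReal_natCast,
      ENNReal.ofReal_sum_of_nonneg fun j _ => det_outerSum_nonneg _ x, ← sum_mul]
    gcongr
    exact le_mul_of_one_le_right' h1
  · refine le_add_right ?_
    rw [mul_one, mul_comm]
    gcongr
    exact not_lt.1 h

variable [MeasurableSpace 𝓨]

theorem measurable_outerSum_apply {m n : ℕ} {ψ : Fin m → 𝓨 → ℝ} (hψ : ∀ j, Measurable (ψ j))
    (i j : Fin m) : Measurable fun x : Fin n → 𝓨 => outerSum ψ x i j := by
  simp only [outerSum, Matrix.sum_apply, vecMulVec_apply]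
  fun_prop

theorem measurable_tailBound {m n : ℕ} {ψ : Fin m → 𝓨 → ℝ} (hψ : ∀ j, Measurable (ψ j))
    (R δ : ℝ) : Measurable (tailBound ψ R δ : (Fin n → 𝓨) → ℝ≥0∞) :=
  (measurable_trace_exp (measurable_outerSum_apply hψ) _).ennreal_ofReal.const_mul _

theorem lintegral_det_mul_inv_lambdaMin_le {m n : ℕ} (hmn : m + 1 < n) {ν : Measure 𝓨}
    [IsProbabilityMeasure ν] {ψ : Fin (m + 1) → 𝓨 → ℝ} (hψ : ∀ j, Measurable (ψ j))
    (h : IsONB ν ψ) {R δ : ℝ} (hR : 1 ≤ R) (hδ0 : 0 < δ) (hδ1 : δ < 1)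
    (hψR : ∀ᵐ y ∂ν, (fun j => ψ j y) ⬝ᵥ (fun j => ψ j y) ≤ R) :
    ∫⁻ x : Fin n → 𝓨, ENNReal.ofReal (outerSum ψ x).det *
        ENNReal.ofReal (lambdaMin ((n : ℝ)⁻¹ • outerSum ψ x))⁻¹ ∂(Measure.pi fun _ => ν) ≤
      ENNReal.ofReal ((1 - δ)⁻¹ * ((n : ℝ) / ((n : ℝ) - (m + 1 : ℕ)))) *
          n.descFactorial (m + 1) +
        n * ((m + 1 : ℕ) * (n.descFactorial m * ENNReal.ofReal ((m + 1 : ℕ) *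
          Real.exp (-(cDelta δ * (n - (m + 1) : ℕ)) / R)))) := by
  have hdet : ∀ {k : ℕ} {χ : Fin k → 𝓨 → ℝ}, (∀ j, Measurable (χ j)) →
      Measurable fun x : Fin n → 𝓨 => ENNReal.ofReal (outerSum χ x).det := fun hχ =>
    (measurable_det (measurable_outerSum_apply hχ)).ennreal_ofReal
  refine (lintegral_mono fun x =>
    ofReal_det_mul_ofReal_inv_lambdaMin_le hmn (by linarith : 0 < R) hδ0 hδ1 ψ x).trans ?_
  rw [lintegral_add_left (((hdet hψ).mul_const _).const_mul _),
    lintegral_const_mul' _ _ ENNReal.ofReal_ne_top,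
    lintegral_const_mul' _ _ (ENNReal.natCast_ne_top n),
    lintegral_finsetSum _ fun j _ =>
      (hdet fun i => hψ (j.succAbove i)).mul (measurable_tailBound hψ R δ)]
  gcongr
  · refine (lintegral_det_mul_le hψ h (E := fun _ => 1) (F := fun _ => 1) measurable_const
      fun _ _ => le_rfl).trans (le_of_eq ?_)
    simp
  · refine (sum_le_sum fun j _ => lintegral_det_mul_tailBound_le m.le_succ hmn.le hψ h
      (Fin.succAbove_right_injective (p := j)) hR hδ0 hδ1 hψR).trans (le_of_eq ?_)
    simp

theorem integral_le_of_lintegral_ofReal_le {κ : Type*} [MeasurableSpace κ] {γ : Measure κ}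
    {f : κ → ℝ} {b : ℝ} (hb : 0 ≤ b) (h : ∫⁻ x, ENNReal.ofReal (f x) ∂γ ≤ ENNReal.ofReal b) :
    ∫ x, f x ∂γ ≤ b := by
  by_cases hf : Integrable f γ
  · rw [integral_eq_lintegral_pos_part_sub_lintegral_neg_part hf]
    exact (sub_le_self _ ENNReal.toReal_nonneg).trans (ENNReal.toReal_le_of_le_ofReal hb h)
  · rwa [integral_undef hf]

theorem card_mul_exp_neg_le {m n : ℕ} (hm : 0 < m) (hn : 0 < n) {c α : ℝ} (hc : 0 < c)
    (hα : 0 < α) (h : (n : ℝ) ≥ m + m * c⁻¹ * α⁻¹ * Real.log ((n : ℝ) * (m : ℝ) ^ 2)) :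
    (n : ℝ) * m * (m * Real.exp (-(c * ((n : ℝ) - m)) / (m / α))) ≤ 1 := by
  have hm' : (0 : ℝ) < m := by exact_mod_cast hm
  have hn' : (0 : ℝ) < n := by exact_mod_cast hn
  have hlog : Real.log ((n : ℝ) * (m : ℝ) ^ 2) ≤ c * ((n : ℝ) - m) / (m / α) := by
    rw [le_div_iff₀ (by positivity)]
    have h2 := mul_le_mul_of_nonneg_left (sub_le_sub_right h (m : ℝ)) hc.le
    refine le_trans (le_of_eq ?_) h2
    field_simp
    ring
  calc _ ≤ (n : ℝ) * m * (m * Real.exp (-Real.log ((n : ℝ) * (m : ℝ) ^ 2))) := by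
        gcongr
        rw [neg_div]
        exact neg_le_neg hlog
    _ = 1 := by
        rw [Real.exp_neg, Real.exp_log (by positivity)]
        field_simp

theorem vs_lt_inv_lambdaMin_le {m n : ℕ} (hm : 0 < m) (hmn : m < n)
    (μ : Measure 𝓨) {φ : Fin m → 𝓨 → ℝ} (hφ : ∀ j, Measurable (φ j)) (horth : IsONB μ φ)
    {w : 𝓨 → ℝ} (hwpos : ∀ x, 0 < w x) (hw : Measurable w) (hwint : ∫ y, w y ∂μ = 1)
    {α : ℝ} (hα : 0 < α) (hwm : ∀ᵐ y ∂μ, α * wChr φ y ≤ w y)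
    {δ : ℝ} (hδ0 : 0 < δ) (hδ1 : δ < 1) :
    (vs μ φ w n)
        {x | (1 - δ)⁻¹ * ((n : ℝ) / ((n : ℝ) - m)) < (lambdaMin (gram φ w x))⁻¹}
      ≤ ENNReal.ofReal ((m : ℝ) * Real.exp (-(cDelta δ * ((n : ℝ) - m) * α) / m)) := by
  have := isProbabilityMeasure_dens hwpos hwint
  have hψ := measurable_scaled hφ hw
  have hb := isONB_scaled horth hwpos hw
  have hψR := ae_scaled_dotProduct_le hm hwpos hα hwm
  have hR : 1 ≤ (m : ℝ) / α :=
    le_trans (by exact_mod_cast hm) (card_le_of_ae_dotProduct_le hψ hb hψR)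
  have hd : (n.descFactorial m : ℝ≥0∞) ≠ 0 := by
    exact_mod_cast (Nat.descFactorial_pos.2 hmn.le).ne'
  calc _ ≤ (vs μ φ w n) {x | 1 ≤ tailBound (scaled φ w) (m / α) δ x} := by
        refine measure_mono fun x hx => ?_
        rw [Set.mem_ofPred_eq, gram_eq_smul_outerSum φ hwpos] at hx
        exact one_le_tailBound hm hmn (by linarith) hδ0 hδ1 _ x hx
    _ ≤ ∫⁻ x, tailBound (scaled φ w) (m / α) δ x ∂(vs μ φ w n) := by
        simpa using mul_meas_ge_le_lintegral (μ := vs μ φ w n)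
          (measurable_tailBound hψ (m / α) δ) 1
    _ ≤ _ := (lintegral_vs_le hmn μ hφ hwpos hw _).trans
        (mul_le_mul' le_rfl (lintegral_det_mul_tailBound_le le_rfl hmn.le hψ hb
          Function.injective_id hR hδ0 hδ1 hψR))
    _ = _ := by
        rw [← mul_assoc, ENNReal.inv_mul_cancel hd (ENNReal.natCast_ne_top _), one_mul,
          Nat.cast_sub hmn.le]
        congr 3
        rw [div_div_eq_mul_div, neg_mul]

theorem integral_inv_lambdaMin_le {m n : ℕ} (hmn : m + 1 < n)
    (μ : Measure 𝓨) {φ : Fin (m + 1) → 𝓨 → ℝ} (hφ : ∀ j, Measurable (φ j)) (horth : IsONB μ φ)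
    {w : 𝓨 → ℝ} (hwpos : ∀ x, 0 < w x) (hw : Measurable w) (hwint : ∫ y, w y ∂μ = 1)
    {α : ℝ} (hα : 0 < α) (hwm : ∀ᵐ y ∂μ, α * wChr φ y ≤ w y)
    {δ : ℝ} (hδ0 : 0 < δ) (hδ1 : δ < 1)
    (hn : (n : ℝ) ≥ (m + 1 : ℕ) + (m + 1 : ℕ) * (cDelta δ)⁻¹ * α⁻¹ *
      Real.log ((n : ℝ) * ((m + 1 : ℕ) : ℝ) ^ 2)) :
    ∫ x, (lambdaMin (gram φ w x))⁻¹ ∂(vs μ φ w n) ≤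
      1 + ((n : ℝ) / ((n : ℝ) - (m + 1 : ℕ))) * (1 - δ)⁻¹ := by
  have := isProbabilityMeasure_dens hwpos hwint
  have hψ := measurable_scaled hφ hw
  have hb := isONB_scaled horth hwpos hw
  have hψR := ae_scaled_dotProduct_le m.succ_pos hwpos hα hwm
  have hR : 1 ≤ ((m + 1 : ℕ) : ℝ) / α :=
    le_trans (by exact_mod_cast m.succ_pos) (card_le_of_ae_dotProduct_le hψ hb hψR)
  have hd : (0 : ℝ) < n.descFactorial m := by
    exact_mod_cast Nat.descFactorial_pos.2 (by omega)
  have hnm : (0 : ℝ) < (n : ℝ) - (m + 1 : ℕ) := sub_pos.2 (by exact_mod_cast hmn)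
  have hδ : 0 < 1 - δ := by linarith
  have hK : 0 ≤ (1 - δ)⁻¹ * ((n : ℝ) / ((n : ℝ) - (m + 1 : ℕ))) := by positivity
  refine integral_le_of_lintegral_ofReal_le (by positivity) ?_
  refine (lintegral_vs_le hmn μ hφ hwpos hw _).trans ?_
  simp only [gram_eq_smul_outerSum φ hwpos]
  refine (mul_le_mul' le_rfl
    (lintegral_det_mul_inv_lambdaMin_le hmn hψ hb hR hδ0 hδ1 hψR)).trans ?_
  have hp := card_mul_exp_neg_le m.succ_pos (by omega : 0 < n) (cDelta_pos hδ0 hδ1) hα hn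
  rw [Nat.cast_sub hmn.le]
  have hdesc : (n.descFactorial (m + 1) : ℝ) = ((n : ℝ) - m) * n.descFactorial m := by
    rw [Nat.descFactorial_succ, Nat.cast_mul, Nat.cast_sub (by omega)]
  have hnm1 : (1 : ℝ) ≤ (n : ℝ) - m := by
    push_cast at hnm
    linarith
  simp only [← ENNReal.ofReal_natCast]
  rw [← ENNReal.ofReal_inv_of_pos (by rw [hdesc]; positivity)]
  rw [← ENNReal.ofReal_mul hK, ← ENNReal.ofReal_mul (by positivity),
    ← ENNReal.ofReal_mul (by positivity), ← ENNReal.ofReal_mul (by positivity),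
    ← ENNReal.ofReal_add (by positivity) (by positivity), ← ENNReal.ofReal_mul (by positivity)]
  refine ENNReal.ofReal_le_ofReal ?_
  rw [hdesc, inv_mul_le_iff₀ (by positivity)]
  have h3 := mul_le_mul_of_nonneg_left (hp.trans hnm1) hd.le
  linear_combination h3

end

end WLSDPP

open WLSDPP in
/-- under volume sampling `γ_n^ν` with `w ≥ α w_m`,
`P(λ_min(G^w)⁻¹ > (1−δ)⁻¹ n/(n−m)) ≤ m exp(−c_δ (n−m) α / m)`, and if
`n ≥ m + m c_δ⁻¹ α⁻¹ log(n m²)` then `E(λ_min(G^w)⁻¹) ≤ 1 + (n/(n−m)) (1−δ)⁻¹`. -/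
theorem statement11 {𝓧 : Type*} [MeasurableSpace 𝓧] {m n : ℕ} (hm : 0 < m) (hmn : m < n)
    (μ : Measure 𝓧) [IsProbabilityMeasure μ]
    (φ : Fin m → 𝓧 → ℝ) (hφ : ∀ j, Measurable (φ j)) (horth : IsONB μ φ)
    (w : 𝓧 → ℝ) (hwpos : ∀ x, 0 < w x) (hw : Measurable w) (hwint : ∫ y, w y ∂μ = 1)
    {α : ℝ} (hα : 0 < α) (hwm : ∀ᵐ y ∂μ, α * wChr φ y ≤ w y)
    {δ : ℝ} (hδ0 : 0 < δ) (hδ1 : δ < 1) :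
    (vs μ φ w n)
        {x | (1 - δ)⁻¹ * ((n : ℝ) / ((n : ℝ) - m)) < (lambdaMin (gram φ w x))⁻¹}
      ≤ ENNReal.ofReal ((m : ℝ) * Real.exp (-(cDelta δ * ((n : ℝ) - m) * α) / m)) ∧
    ((n : ℝ) ≥ m + m * (cDelta δ)⁻¹ * α⁻¹ * Real.log ((n : ℝ) * (m : ℝ) ^ 2) →
      ∫ x, (lambdaMin (gram φ w x))⁻¹ ∂(vs μ φ w n)
        ≤ 1 + ((n : ℝ) / ((n : ℝ) - m)) * (1 - δ)⁻¹) := by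
  refine ⟨vs_lt_inv_lambdaMin_le hm hmn μ hφ horth hwpos hw hwint hα hwm hδ0 hδ1, fun hn => ?_⟩
  cases m with
  | zero => exact absurd hm (lt_irrefl 0)
  | succ m => exact integral_inv_lambdaMin_le hmn μ hφ horth hwpos hw hwint hα hwm hδ0 hδ1 hn
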